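/- Let q ∈ ℂ with 0 < |q| < 1 and x ∈ ℂ* generic. Then j(q x³; q³) + x · j(q² x³; q³) = J₁ · j(x²;q) / j(x;q), where j(z;q) := (z;q)_∞(q/z;q)_∞(q;q)_∞ and J₁ := (q;q)_∞. -/

import Mathlib

noncomputable def qPoch (x q : ℂ) : ℂ := ∏' k : ℕ, (1 - x * q ^ k)

noncomputable def jP (z q : ℂ) : ℂ := qPoch z q * qPoch (q / z) q * qPoch q q

open Filter Topology

lemma summable_norm_mul_pow {q : ℂ} (hq : ‖q‖ < 1) (a : ℂ) :
    Summable fun k : ℕ => ‖-(a * q ^ k)‖ := by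
  simpa using (summable_geometric_of_lt_one (norm_nonneg q) hq).mul_left ‖a‖

lemma tendsto_prod_qPoch {q : ℂ} (hq : ‖q‖ < 1) (a : ℂ) :
    Tendsto (fun n : ℕ => ∏ k ∈ Finset.range n, (1 - a * q ^ k)) atTop (𝓝 (qPoch a q)) := by
  have h := (multipliable_one_add_of_summable (summable_norm_mul_pow hq a)).tendsto_prod_tprod_nat
  simpa [qPoch, sub_eq_add_neg] using h

lemma one_sub_pow_ne_zero {q : ℂ} (hq : ‖q‖ < 1) {n : ℕ} (hn : n ≠ 0) : 1 - q ^ n ≠ 0 := by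
  intro h
  have h1 : ‖q ^ n‖ < 1 := by
    rw [norm_pow]
    exact pow_lt_one₀ (norm_nonneg q) hq hn
  rw [← sub_eq_zero.mp h, norm_one] at h1
  exact lt_irrefl _ h1

lemma qPoch_self_ne_zero {q : ℂ} (hq : ‖q‖ < 1) : qPoch q q ≠ 0 := by
  have h := tprod_one_add_ne_zero_of_summable (f := fun k : ℕ => -(q * q ^ k)) (fun k => by
    rw [← sub_eq_add_neg, ← pow_succ']
    exact one_sub_pow_ne_zero hq k.succ_ne_zero) (summable_norm_mul_pow hq q)
  simpa [qPoch, sub_eq_add_neg] using h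

/-- The finite product `(q;q)_n`. -/
noncomputable def qFactorial (q : ℂ) (n : ℕ) : ℂ := ∏ k ∈ Finset.range n, (1 - q * q ^ k)

lemma qFactorial_succ (q : ℂ) (n : ℕ) :
    qFactorial q (n + 1) = qFactorial q n * (1 - q ^ (n + 1)) := by
  rw [qFactorial, Finset.prod_range_succ, ← pow_succ', qFactorial]

lemma qFactorial_ne_zero {q : ℂ} (hq : ‖q‖ < 1) (n : ℕ) : qFactorial q n ≠ 0 :=
  Finset.prod_ne_zero_iff.mpr fun k _ => by
    rw [← pow_succ']
    exact one_sub_pow_ne_zero hq k.succ_ne_zero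

/-- The reciprocal of `(q;q)_m`, extended by zero to negative `m`. -/
noncomputable def qFactorialInv (q : ℂ) (m : ℤ) : ℂ :=
  if m < 0 then 0 else (qFactorial q m.toNat)⁻¹

lemma qFactorialInv_natCast (q : ℂ) (n : ℕ) : qFactorialInv q n = (qFactorial q n)⁻¹ := by
  simp [qFactorialInv]

lemma qFactorialInv_of_neg (q : ℂ) {m : ℤ} (hm : m < 0) : qFactorialInv q m = 0 := if_pos hm

lemma qFactorialInv_eq_mul_add_one {q : ℂ} (hq : ‖q‖ < 1) (m : ℤ) :
    qFactorialInv q m = (1 - q ^ (m + 1)) * qFactorialInv q (m + 1) := by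
  rcases lt_trichotomy m (-1) with h | rfl | h
  · rw [qFactorialInv_of_neg q (by lia), qFactorialInv_of_neg q (by lia), mul_zero]
  · simp [qFactorialInv_of_neg]
  · lift m to ℕ using by lia
    have h1 := one_sub_pow_ne_zero hq m.succ_ne_zero
    have h2 := qFactorial_ne_zero hq m
    rw [← Nat.cast_succ, qFactorialInv_natCast, qFactorialInv_natCast, Nat.succ_eq_add_one,
      qFactorial_succ, zpow_natCast]
    field_simp

lemma tendsto_qFactorialInv {q : ℂ} (hq : ‖q‖ < 1) {u : ℕ → ℤ} (hu : Tendsto u atTop atTop) :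
    Tendsto (fun n => qFactorialInv q (u n)) atTop (𝓝 (qPoch q q)⁻¹) := by
  have h : Tendsto (fun m : ℤ => (qFactorial q m.toNat)⁻¹) atTop (𝓝 (qPoch q q)⁻¹) :=
    ((tendsto_prod_qPoch hq q).comp
      (tendsto_atTop.mpr fun b => (eventually_ge_atTop (b : ℤ)).mono fun m hm => by lia)).inv₀
      (qPoch_self_ne_zero hq)
  refine (h.comp hu).congr' ?_
  filter_upwards [hu.eventually_ge_atTop 0] with n hn
  simp [qFactorialInv, hn.not_gt]

lemma exists_norm_qFactorial_le {q : ℂ} (hq : ‖q‖ < 1) :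
    ∃ C, 0 ≤ C ∧ ∀ n, ‖qFactorial q n‖ ≤ C := by
  obtain ⟨C, hC⟩ := (Metric.isBounded_range_of_tendsto _
    (tendsto_prod_qPoch hq q)).exists_norm_le
  exact ⟨C, (norm_nonneg _).trans (hC _ ⟨0, rfl⟩), fun n => hC _ ⟨n, rfl⟩⟩

lemma exists_norm_qFactorialInv_le {q : ℂ} (hq : ‖q‖ < 1) :
    ∃ C, 0 ≤ C ∧ ∀ m, ‖qFactorialInv q m‖ ≤ C := by
  obtain ⟨C, hC⟩ := (Metric.isBounded_range_of_tendsto _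
    (tendsto_qFactorialInv hq tendsto_natCast_atTop_atTop)).exists_norm_le
  have hC0 := (norm_nonneg _).trans (hC _ ⟨0, rfl⟩)
  refine ⟨C, hC0, fun m => ?_⟩
  rcases lt_or_ge m 0 with h | h
  · rwa [qFactorialInv_of_neg q h, norm_zero]
  · lift m to ℕ using h
    exact hC _ ⟨m, rfl⟩

/-- The binomial coefficient `n(n-1)/2` for an integer `n`. -/
def intTri (n : ℤ) : ℤ := n * (n - 1) / 2

lemma two_mul_intTri (n : ℤ) : 2 * intTri n = n * (n - 1) :=
  Int.mul_ediv_cancel' (Int.even_mul_pred_self n).two_dvd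

/-- The general term of the theta series of `jP z q`. -/
noncomputable def thetaTerm (q z : ℂ) (n : ℤ) : ℂ := (-1) ^ n * q ^ intTri n * z ^ n

lemma thetaTerm_ne_zero {q z : ℂ} (hq0 : q ≠ 0) (hz : z ≠ 0) (n : ℤ) : thetaTerm q z n ≠ 0 := by
  exact mul_ne_zero (mul_ne_zero (zpow_ne_zero n (by norm_num)) (zpow_ne_zero _ hq0))
    (zpow_ne_zero n hz)

lemma thetaTerm_add_one {q z : ℂ} (hq0 : q ≠ 0) (hz : z ≠ 0) (n : ℤ) :
    thetaTerm q z (n + 1) = -(z * q ^ n) * thetaTerm q z n := by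
  have h : intTri (n + 1) = intTri n + n := by
    linarith [two_mul_intTri n, two_mul_intTri (n + 1)]
  rw [thetaTerm, thetaTerm, h, zpow_add₀ hq0, zpow_add_one₀ hz, zpow_add_one₀ (by norm_num)]
  ring

lemma thetaTerm_neg {q : ℂ} (hq0 : q ≠ 0) (z : ℂ) (n : ℤ) :
    thetaTerm q z (-n) = thetaTerm q (q / z) n := by
  have h : intTri (-n) = intTri n + n := by
    linarith [two_mul_intTri n, two_mul_intTri (-n)]
  rw [thetaTerm, thetaTerm, h, zpow_add₀ hq0, div_zpow, zpow_neg z, zpow_neg (-1), ← inv_zpow]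
  norm_num
  ring

lemma summable_thetaTerm_nat {q z : ℂ} (hq0 : q ≠ 0) (hq : ‖q‖ < 1) (hz : z ≠ 0) :
    Summable fun n : ℕ => thetaTerm q z n := by
  refine summable_of_ratio_test_tendsto_lt_one (l := 0) one_pos
    (Eventually.of_forall fun n => thetaTerm_ne_zero hq0 hz n) ?_
  have h := ((tendsto_pow_atTop_nhds_zero_of_lt_one (norm_nonneg q) hq).const_mul ‖z‖)
  rw [mul_zero] at h
  refine h.congr fun n => ?_
  rw [Nat.cast_succ, thetaTerm_add_one hq0 hz, norm_mul,
    mul_div_cancel_right₀ _ (norm_ne_zero_iff.mpr (thetaTerm_ne_zero hq0 hz _))]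
  simp

lemma summable_thetaTerm {q z : ℂ} (hq0 : q ≠ 0) (hq : ‖q‖ < 1) (hz : z ≠ 0) :
    Summable (thetaTerm q z) := by
  refine .of_nat_of_neg_add_one (summable_thetaTerm_nat hq0 hq hz) ?_
  have h := (summable_nat_add_iff 1).mpr
    (summable_thetaTerm_nat hq0 hq (div_ne_zero hq0 hz))
  refine h.congr fun n => ?_
  rw [thetaTerm_neg hq0, Nat.cast_succ]

/-- The finite form of the Jacobi triple product identity. -/
lemma hasSum_thetaTerm_mul_qBinomial {q z : ℂ} (hq0 : q ≠ 0) (hq : ‖q‖ < 1) (hz : z ≠ 0) (n : ℕ) :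
    HasSum (fun j : ℤ => thetaTerm q z j *
        (qFactorial q (2 * n) * qFactorialInv q (n + j) * qFactorialInv q (n - j)))
      ((∏ k ∈ Finset.range n, (1 - z * q ^ k)) * ∏ k ∈ Finset.range n, (1 - q / z * q ^ k)) := by
  induction n with
  | zero =>
    convert hasSum_single (0 : ℤ) ?_ using 1
    · simp [thetaTerm, intTri, qFactorial, qFactorialInv]
    · intro j hj
      rcases hj.lt_or_gt with h | h
      · rw [qFactorialInv_of_neg q (m := ((0 : ℕ) : ℤ) + j) (by simpa using h)]
        ring
      · rw [qFactorialInv_of_neg q (m := ((0 : ℕ) : ℤ) - j) (by simpa using h)]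
        ring
  | succ n ih =>
    set P := (∏ k ∈ Finset.range n, (1 - z * q ^ k)) *
      ∏ k ∈ Finset.range n, (1 - q / z * q ^ k) with hPdef
    have h1 := ((Equiv.subRight (1 : ℤ)).hasSum_iff.mpr ih).mul_left (-(z * q ^ n))
    have h2 := ((Equiv.addRight (1 : ℤ)).hasSum_iff.mpr ih).mul_left (-(q ^ (n + 1) / z))
    have h3 := ih.mul_left (1 + q ^ (2 * n + 1))
    have hP : (∏ k ∈ Finset.range (n + 1), (1 - z * q ^ k)) *
        ∏ k ∈ Finset.range (n + 1), (1 - q / z * q ^ k) = (1 + q ^ (2 * n + 1)) * P +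
          -(z * q ^ n) * P + -(q ^ (n + 1) / z) * P := by
      rw [hPdef, Finset.prod_range_succ, Finset.prod_range_succ]
      field_simp
      ring
    rw [hP]
    refine Eq.subst (motive := fun f => HasSum f _) (funext fun j => ?_) ((h3.add h1).add h2)
    symm
    simp only [Function.comp_apply, Equiv.coe_addRight, Equiv.subRight_apply]
    have e1 := thetaTerm_add_one hq0 hz j
    have e2 := thetaTerm_add_one hq0 hz (j - 1)
    rw [sub_add_cancel] at e2
    have f1 := qFactorialInv_eq_mul_add_one hq (n + j)
    have f2 := qFactorialInv_eq_mul_add_one hq (n - j)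
    have f3 := qFactorialInv_eq_mul_add_one hq (n + j - 1)
    have f4 := qFactorialInv_eq_mul_add_one hq (n - j - 1)
    rw [sub_add_cancel] at f3 f4
    rw [show (n : ℤ) + (j - 1) = n + j - 1 by ring, show (n : ℤ) - (j - 1) = n - j + 1 by ring,
      show (n : ℤ) + (j + 1) = n + j + 1 by ring, show (n : ℤ) - (j + 1) = n - j - 1 by ring,
      f3, f4, f1, f2, show 2 * (n + 1) = 2 * n + 1 + 1 by ring, qFactorial_succ, qFactorial_succ,
      show ((n + 1 : ℕ) : ℤ) + j = n + j + 1 by push_cast; ring,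
      show ((n + 1 : ℕ) : ℤ) - j = n - j + 1 by push_cast; ring, e1, e2]
    simp only [zpow_add₀ hq0, zpow_sub₀ hq0, zpow_natCast, zpow_one]
    have hj : q ^ j ≠ 0 := zpow_ne_zero j hq0
    field_simp
    ring

/-- The Jacobi triple product identity. -/
theorem hasSum_thetaTerm {q z : ℂ} (hq0 : q ≠ 0) (hq : ‖q‖ < 1) (hz : z ≠ 0) :
    HasSum (thetaTerm q z) (jP z q) := by
  have hL := qPoch_self_ne_zero hq
  have hs := summable_thetaTerm hq0 hq hz
  obtain ⟨C, hC0, hC⟩ := exists_norm_qFactorial_le hq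
  obtain ⟨D, hD0, hD⟩ := exists_norm_qFactorialInv_le hq
  have h1 := tendsto_tsum_of_dominated_convergence (𝓕 := atTop)
    (f := fun (n : ℕ) (j : ℤ) => thetaTerm q z j *
        (qFactorial q (2 * n) * qFactorialInv q (n + j) * qFactorialInv q (n - j)))
    (g := fun j => thetaTerm q z j * (qPoch q q * (qPoch q q)⁻¹ * (qPoch q q)⁻¹))
    (bound := fun j => ‖thetaTerm q z j‖ * (C * D * D)) (hs.norm.mul_right _)
    (fun j => by
      refine Tendsto.const_mul _ (((?_ : Tendsto _ _ _).mul
        (tendsto_qFactorialInv hq ?_)).mul (tendsto_qFactorialInv hq ?_))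
      · exact (tendsto_prod_qPoch hq q).comp (tendsto_id.const_mul_atTop' two_pos)
      · exact tendsto_atTop_add_const_right _ _ tendsto_natCast_atTop_atTop
      · exact tendsto_atTop_add_const_right _ _ tendsto_natCast_atTop_atTop)
    (Eventually.of_forall fun n j => by
      rw [norm_mul, norm_mul, norm_mul]
      gcongr
      exacts [hC _, hD _, hD _])
  simp only [(hasSum_thetaTerm_mul_qBinomial hq0 hq hz _).tsum_eq] at h1
  have h2 := tendsto_nhds_unique h1
    ((tendsto_prod_qPoch hq z).mul (tendsto_prod_qPoch hq (q / z)))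
  rw [tsum_mul_right, mul_inv_cancel₀ hL, one_mul, ← div_eq_mul_inv, div_eq_iff hL] at h2
  rw [jP, ← h2]
  exact hs.hasSum

lemma qPoch_self_eq_jP_cube {q : ℂ} (hq0 : q ≠ 0) (hq : ‖q‖ < 1) :
    qPoch q q = jP q (q ^ 3) := by
  have hq3 : ‖q ^ 3‖ < 1 := by
    rw [norm_pow]
    exact pow_lt_one₀ (norm_nonneg q) hq (by norm_num)
  have h1 := (tendsto_prod_qPoch hq q).comp (tendsto_id.const_mul_atTop' (three_pos (α := ℕ)))
  have h2 := ((tendsto_prod_qPoch hq3 q).mul (tendsto_prod_qPoch hq3 (q ^ 3 / q))).mul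
    (tendsto_prod_qPoch hq3 (q ^ 3))
  refine tendsto_nhds_unique h1 (h2.congr fun n => ?_)
  simp only [Function.comp_apply, id_eq]
  induction n with
  | zero => simp
  | succ n ih =>
    rw [show 3 * (n + 1) = 3 * n + 1 + 1 + 1 by ring]
    simp only [Finset.prod_range_succ]
    rw [← ih, show q ^ 3 / q = q ^ 2 by field_simp]
    ring

lemma HasSum.of_isCompl_range {ι κ κ' : Type*} {f : ι → ℂ} {g : κ → ι} {h : κ' → ι} {a : ℂ}
    (hf : HasSum f a) (hg : g.Injective) (hh : h.Injective)
    (hc : IsCompl (Set.range g) (Set.range h)) :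
    a = ∑' k, f (g k) + ∑' k, f (h k) := by
  have h1 := hg.hasSum_range_iff.mpr (hf.summable.comp_injective hg).hasSum
  have h2 := hh.hasSum_range_iff.mpr (hf.summable.comp_injective hh).hasSum
  exact hf.unique (h1.add_isCompl hc h2)

lemma HasSum.mul_complex {ι κ : Type*} {f : ι → ℂ} {g : κ → ℂ} {a b : ℂ}
    (hf : HasSum f a) (hg : HasSum g b) :
    HasSum (fun p : ι × κ => f p.1 * g p.2) (a * b) :=
  hf.mul hg (summable_mul_of_summable_norm hf.summable.norm hg.summable.norm)

lemma isCompl_range_prod {g h : ℤ × ℤ → ℤ × ℤ} (hd : ∀ p r, g p ≠ h r)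
    (hc : ∀ p, (∃ r, g r = p) ∨ ∃ r, h r = p) : IsCompl (Set.range g) (Set.range h) := by
  refine ⟨Set.disjoint_left.mpr ?_, codisjoint_iff_le_sup.mpr fun p _ => hc p⟩
  rintro _ ⟨p, rfl⟩ ⟨r, hr⟩
  exact hd p r hr.symm

lemma neg_one_zpow_congr {a b c : ℤ} (h : a - b = 2 * c) : (-1 : ℂ) ^ a = (-1) ^ b := by
  rw [sub_eq_iff_eq_add.mp h, zpow_add₀ (by norm_num), zpow_mul]
  norm_num

lemma mul_signed_monomial {q x : ℂ} (hq0 : q ≠ 0) (hx : x ≠ 0) (a b c a' b' c' : ℤ) :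
    ((-1) ^ a * q ^ b * x ^ c) * ((-1) ^ a' * q ^ b' * x ^ c') =
      (-1) ^ (a + a') * q ^ (b + b') * x ^ (c + c') := by
  rw [zpow_add₀ (by norm_num), zpow_add₀ hq0, zpow_add₀ hx]
  ring

lemma thetaTerm_cube {q x : ℂ} (hq0 : q ≠ 0) (r n m : ℤ) :
    thetaTerm (q ^ 3) (q ^ r * x ^ m) n =
      (-1) ^ n * q ^ (3 * intTri n + r * n) * x ^ (m * n) := by
  rw [thetaTerm, mul_zpow, ← zpow_mul, ← zpow_mul, zpow_add₀ hq0, zpow_mul q 3]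
  norm_cast
  ring

lemma signed_monomial_congr {q x : ℂ} {a b c a' b' c' : ℤ} (d : ℤ) (ha : a - a' = 2 * d)
    (hb : 2 * b = 2 * b') (hc : c = c') :
    (-1 : ℂ) ^ a * q ^ b * x ^ c = (-1) ^ a' * q ^ b' * x ^ c' := by
  rw [neg_one_zpow_congr ha, Int.eq_of_mul_eq_mul_left two_ne_zero hb, hc]

lemma signed_monomial_congr_neg {q x : ℂ} {a b c a' b' c' : ℤ} (d : ℤ) (ha : a - a' = 2 * d + 1)
    (hb : 2 * b = 2 * b') (hc : c = c') :
    (-1 : ℂ) ^ a * q ^ b * x ^ c = -((-1) ^ a' * q ^ b' * x ^ c') := by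
  rw [signed_monomial_congr (a' := a' + 1) d (by linarith) hb hc, zpow_add_one₀ (by norm_num)]
  ring

theorem jP_cube_add_mul_jP {q x : ℂ} (hq0 : q ≠ 0) (hq : ‖q‖ < 1) (hx : x ≠ 0) :
    (jP (q * x ^ 3) (q ^ 3) + x * jP (q ^ 2 * x ^ 3) (q ^ 3)) * jP x q =
      qPoch q q * jP (x ^ 2) q := by
  have hq3 : ‖q ^ 3‖ < 1 := by
    rw [norm_pow]
    exact pow_lt_one₀ (norm_nonneg q) hq (by norm_num)
  have hq30 : q ^ 3 ≠ 0 := pow_ne_zero 3 hq0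
  have hβ := hasSum_thetaTerm hq0 hq hx
  have hA := (hasSum_thetaTerm hq30 hq3 (mul_ne_zero hq0 (pow_ne_zero 3 hx))).mul_complex hβ
  have hB := ((hasSum_thetaTerm hq30 hq3
    (mul_ne_zero (pow_ne_zero 2 hq0) (pow_ne_zero 3 hx))).mul_left x).mul_complex hβ
  have hC := (hasSum_thetaTerm hq30 hq3 hq0).mul_complex
    (hasSum_thetaTerm hq0 hq (pow_ne_zero 2 hx))
  rw [← qPoch_self_eq_jP_cube hq0 hq] at hC
  have eA (n m : ℤ) : thetaTerm (q ^ 3) (q * x ^ 3) n * thetaTerm q x m =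
      (-1) ^ (n + m) * q ^ (3 * intTri n + 1 * n + intTri m) * x ^ (3 * n + m) := by
    rw [← mul_signed_monomial hq0 hx, ← thetaTerm_cube hq0]
    norm_cast
    simp [thetaTerm]
  have eB (n m : ℤ) : x * thetaTerm (q ^ 3) (q ^ 2 * x ^ 3) n * thetaTerm q x m =
      (-1) ^ (n + m) * q ^ (3 * intTri n + 2 * n + intTri m) * x ^ (3 * n + m + 1) := by
    rw [zpow_add_one₀ hx, ← mul_assoc, mul_comm _ x, ← mul_signed_monomial hq0 hx,
      ← thetaTerm_cube hq0, ← mul_assoc]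
    norm_cast
    simp [thetaTerm]
  have eC (l k : ℤ) : thetaTerm (q ^ 3) q l * thetaTerm q (x ^ 2) k =
      (-1) ^ (l + k) * q ^ (3 * intTri l + 1 * l + intTri k) * x ^ (0 * l + 2 * k) := by
    rw [← mul_signed_monomial hq0 hx, ← thetaTerm_cube hq0, thetaTerm, thetaTerm, thetaTerm,
      zpow_mul x 2]
    norm_cast
    simp
  simp only [eA] at hA
  simp only [eB] at hB
  simp only [eC] at hC
  have sA := hA.of_isCompl_range (g := fun p : ℤ × ℤ => (p.1, 2 * p.2 - 3 * p.1))
    (h := fun p : ℤ × ℤ => (p.1, 2 * p.2 + 1 - 3 * p.1))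
    (fun p r h => by simp only [Prod.mk.injEq] at h; ext <;> lia)
    (fun p r h => by simp only [Prod.mk.injEq] at h; ext <;> lia)
    (isCompl_range_prod (fun p r h => by simp only [Prod.mk.injEq] at h; lia) fun p => by
      rcases Int.even_or_odd' (p.2 + 3 * p.1) with ⟨k, hk | hk⟩
      · exact .inl ⟨(p.1, k), by ext <;> simp only; lia⟩
      · exact .inr ⟨(p.1, k), by ext <;> simp only; lia⟩)
  have sB := hB.of_isCompl_range (g := fun p : ℤ × ℤ => (p.1, 2 * p.2 - 3 * p.1 - 1))
    (h := fun p : ℤ × ℤ => (p.1, 2 * p.2 - 3 * p.1))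
    (fun p r h => by simp only [Prod.mk.injEq] at h; ext <;> lia)
    (fun p r h => by simp only [Prod.mk.injEq] at h; ext <;> lia)
    (isCompl_range_prod (fun p r h => by simp only [Prod.mk.injEq] at h; lia) fun p => by
      rcases Int.even_or_odd' (p.2 + 3 * p.1 + 1) with ⟨k, hk | hk⟩
      · exact .inl ⟨(p.1, k), by ext <;> simp only; lia⟩
      · exact .inr ⟨(p.1, k), by ext <;> simp only; lia⟩)
  have sC := hC.of_isCompl_range (g := fun p : ℤ × ℤ => (p.2 - 2 * p.1, p.2))
    (h := fun p : ℤ × ℤ => (2 * p.1 + 1 - p.2, p.2))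
    (fun p r h => by simp only [Prod.mk.injEq] at h; ext <;> lia)
    (fun p r h => by simp only [Prod.mk.injEq] at h; ext <;> lia)
    (isCompl_range_prod (fun p r h => by simp only [Prod.mk.injEq] at h; lia) fun p => by
      rcases Int.even_or_odd' (p.1 + p.2) with ⟨k, hk | hk⟩
      · exact .inl ⟨(p.2 - k, p.2), by ext <;> simp only; lia⟩
      · exact .inr ⟨(k, p.2), by ext <;> simp only; lia⟩)
  let e : ℤ × ℤ ≃ ℤ × ℤ :=
    { toFun := fun p => (p.2 - p.1, p.2)
      invFun := fun p => (p.2 - p.1, p.2)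
      left_inv := fun p => by simp
      right_inv := fun p => by simp }
  rw [add_mul, sA, sB, sC, add_add_add_comm]
  rw [← e.tsum_eq (fun p : ℤ × ℤ => (-1 : ℂ) ^ (p.1 + (2 * p.2 - 3 * p.1)) *
    q ^ (3 * intTri p.1 + 2 * p.1 + intTri (2 * p.2 - 3 * p.1)) *
      x ^ (3 * p.1 + (2 * p.2 - 3 * p.1) + 1))]
  have hodd (p : ℤ × ℤ) : (-1 : ℂ) ^ (p.1 + (2 * p.2 + 1 - 3 * p.1)) *
      q ^ (3 * intTri p.1 + 1 * p.1 + intTri (2 * p.2 + 1 - 3 * p.1)) *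
        x ^ (3 * p.1 + (2 * p.2 + 1 - 3 * p.1)) =
      -((-1 : ℂ) ^ ((e p).1 + (2 * (e p).2 - 3 * (e p).1)) *
        q ^ (3 * intTri (e p).1 + 2 * (e p).1 + intTri (2 * (e p).2 - 3 * (e p).1)) *
          x ^ (3 * (e p).1 + (2 * (e p).2 - 3 * (e p).1) + 1)) := by
    obtain ⟨n, k⟩ := p
    simp only [e, Equiv.coe_fn_mk]
    refine signed_monomial_congr_neg (k - 2 * n) (by ring) ?_ (by ring)
    linarith [two_mul_intTri n, two_mul_intTri (k - n), two_mul_intTri (2 * k + 1 - 3 * n),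
      two_mul_intTri (2 * k - 3 * (k - n))]
  have hevenA (p : ℤ × ℤ) : (-1 : ℂ) ^ (p.1 + (2 * p.2 - 3 * p.1)) *
      q ^ (3 * intTri p.1 + 1 * p.1 + intTri (2 * p.2 - 3 * p.1)) *
        x ^ (3 * p.1 + (2 * p.2 - 3 * p.1)) =
      (-1 : ℂ) ^ (p.2 - 2 * p.1 + p.2) *
        q ^ (3 * intTri (p.2 - 2 * p.1) + 1 * (p.2 - 2 * p.1) + intTri p.2) *
          x ^ (0 * (p.2 - 2 * p.1) + 2 * p.2) := by
    obtain ⟨n, k⟩ := p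
    refine signed_monomial_congr 0 (by ring) ?_ (by ring)
    linarith [two_mul_intTri n, two_mul_intTri k, two_mul_intTri (2 * k - 3 * n),
      two_mul_intTri (k - 2 * n)]
  have hevenB (p : ℤ × ℤ) : (-1 : ℂ) ^ (p.1 + (2 * p.2 - 3 * p.1 - 1)) *
      q ^ (3 * intTri p.1 + 2 * p.1 + intTri (2 * p.2 - 3 * p.1 - 1)) *
        x ^ (3 * p.1 + (2 * p.2 - 3 * p.1 - 1) + 1) =
      (-1 : ℂ) ^ (2 * p.1 + 1 - p.2 + p.2) *
        q ^ (3 * intTri (2 * p.1 + 1 - p.2) + 1 * (2 * p.1 + 1 - p.2) + intTri p.2) *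
          x ^ (0 * (2 * p.1 + 1 - p.2) + 2 * p.2) := by
    obtain ⟨n, k⟩ := p
    refine signed_monomial_congr (k - 2 * n - 1) (by ring) ?_ (by ring)
    linarith [two_mul_intTri n, two_mul_intTri k, two_mul_intTri (2 * k - 3 * n - 1),
      two_mul_intTri (2 * n + 1 - k)]
  simp only [hodd, hevenA, hevenB, tsum_neg, neg_add_cancel, add_zero]

theorem jP_quintuple_type (q x : ℂ) (hq0 : q ≠ 0) (hq : ‖q‖ < 1)
    (hx : x ≠ 0) (hxj : jP x q ≠ 0) :
    jP (q * x ^ 3) (q ^ 3) + x * jP (q ^ 2 * x ^ 3) (q ^ 3) =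
      qPoch q q * jP (x ^ 2) q / jP x q :=
  eq_div_of_mul_eq hxj (jP_cube_add_mul_jP hq0 hq hx)
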